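/- Let α ∈ (0, 1), let b > 0, let C ≥ 0, and let T > 0. Suppose f : ℝ → ℝ is continuous on [0, T], differentiable on (0, T), satisfies f(0) = 0, and satisfies the differential inequality f'(t) ≤ −b·t^{−α}·f(t) + C for all t ∈ (0, T). Then f(T) ≤ C · exp(−(b/(1−α))·T^{1−α}) · ∫₀^T exp((b/(1−α))·u^{1−α}) du. -/

import Mathlib

/-- Grönwall inequality in integrating-factor form: if `f' ≤ -Φ' f + C` on `(a, b)`, then
`exp Φ * f - C * ∫ exp Φ` does not increase from `a` to `b`. -/
theorem exp_mul_le_of_deriv_le {a b C : ℝ} (hab : a ≤ b) {f f' Φ Φ' : ℝ → ℝ}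
    (hf : ContinuousOn f (Set.Icc a b)) (hΦ : Continuous Φ)
    (hf' : ∀ t ∈ Set.Ioo a b, HasDerivAt f (f' t) t)
    (hΦ' : ∀ t ∈ Set.Ioo a b, HasDerivAt Φ (Φ' t) t)
    (hle : ∀ t ∈ Set.Ioo a b, f' t ≤ -(Φ' t * f t) + C) :
    Real.exp (Φ b) * f b ≤ Real.exp (Φ a) * f a + C * ∫ u in a..b, Real.exp (Φ u) := by
  have hexp : Continuous fun u => Real.exp (Φ u) := Real.continuous_exp.comp hΦ
  let G : ℝ → ℝ := fun t => Real.exp (Φ t) * f t - C * ∫ u in a..t, Real.exp (Φ u)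
  have hGcont : ContinuousOn G (Set.Icc a b) :=
    (hexp.continuousOn.mul hf).sub (continuous_const.mul
      (intervalIntegral.continuous_primitive (fun _ _ => hexp.intervalIntegrable _ _) a)).continuousOn
  have hG : ∀ t ∈ Set.Ioo a b, HasDerivAt G
      (Real.exp (Φ t) * Φ' t * f t + Real.exp (Φ t) * f' t - C * Real.exp (Φ t)) t :=
    fun t ht => ((hΦ' t ht).exp.mul (hf' t ht)).sub
      ((hexp.integral_hasStrictDerivAt a t).hasDerivAt.const_mul C)
  have hanti : AntitoneOn G (Set.Icc a b) := by
    refine antitoneOn_of_deriv_nonpos (convex_Icc a b) hGcont ?_ ?_ <;> rw [interior_Icc]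
    · exact fun t ht => (hG t ht).differentiableAt.differentiableWithinAt
    · intro t ht
      rw [(hG t ht).deriv]
      linarith [mul_le_mul_of_nonneg_left (hle t ht) (Real.exp_pos (Φ t)).le]
  have h := hanti (Set.left_mem_Icc.mpr hab) (Set.right_mem_Icc.mpr hab) hab
  simp only [G, intervalIntegral.integral_same, mul_zero, sub_zero] at h
  linarith

/-- Grönwall-type lemma: if `f(0) = 0` and `f'(t) ≤ −b t^{−α} f(t) + C` on `(0, T)`,
then `f(T) ≤ C · exp(−(b/(1−α)) T^{1−α}) · ∫₀^T exp((b/(1−α)) u^{1−α}) du`. -/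
theorem gronwall_power_weight
    (α b C T : ℝ) (hα : α ∈ Set.Ioo (0 : ℝ) 1) (hb : 0 < b) (hC : 0 ≤ C) (hT : 0 < T)
    (f f' : ℝ → ℝ)
    (hcont : ContinuousOn f (Set.Icc 0 T))
    (hderiv : ∀ t ∈ Set.Ioo (0 : ℝ) T, HasDerivAt f (f' t) t)
    (h0 : f 0 = 0)
    (hineq : ∀ t ∈ Set.Ioo (0 : ℝ) T, f' t ≤ -b * t ^ (-α) * f t + C) :
    f T ≤ C * Real.exp (-(b / (1 - α)) * T ^ (1 - α)) *
      ∫ u in (0 : ℝ)..T, Real.exp ((b / (1 - α)) * u ^ (1 - α)) := by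
  have hα' : 0 < 1 - α := sub_pos.mpr hα.2
  have hΦ : Continuous fun u : ℝ => b / (1 - α) * u ^ (1 - α) :=
    continuous_const.mul (Real.continuous_rpow_const hα'.le)
  have hΦ' : ∀ t ∈ Set.Ioo (0 : ℝ) T,
      HasDerivAt (fun u : ℝ => b / (1 - α) * u ^ (1 - α)) (b * t ^ (-α)) t := by
    intro t ht
    have h := (Real.hasDerivAt_rpow_const (p := 1 - α) (Or.inl ht.1.ne')).const_mul (b / (1 - α))
    rwa [sub_sub_cancel_left, ← mul_assoc, div_mul_cancel₀ b hα'.ne'] at h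
  have h := exp_mul_le_of_deriv_le hT.le hcont hΦ hderiv hΦ' fun t ht => by
    simpa only [neg_mul] using hineq t ht
  rw [h0, mul_zero, zero_add] at h
  rw [neg_mul, Real.exp_neg, mul_right_comm, ← div_eq_mul_inv, le_div_iff₀' (Real.exp_pos _)]
  exact h
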